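/- Let r be the partial run profile after R ≥ 1 steps of the run of the train from o to d, and let u be the train's position after R−1 steps (the vertex visited at step R−1). Then either (i) v_r has exactly one in-neighbor in the graph of last-used edges G*_r, and this in-neighbor is u, or (ii) G*_r contains exactly one directed cycle, this cycle contains v_r, and u is the predecessor of v_r on this cycle (i.e., the edge of the cycle entering v_r starts at u). -/

import Mathlib

/-- One step of the train process: from a configuration (position, current switch
settings), the train moves along the current switch edge of its position and that
switch flips. `false` stands for the switch `s0`, `true` for `s1`. -/
def trainStep {V : Type} [DecidableEq V] (s : Bool → V → V) (st : V × (V → Bool)) :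
    V × (V → Bool) :=
  (s (st.2 st.1) st.1, Function.update st.2 st.1 (!(st.2 st.1)))

/-- Configuration (position, switch settings) of the run of the train from `o` to `d`
after `k` steps; the train starts at `o` with all switches set to `s0` and the process
stops when the train first reaches `d`. -/
def runState {V : Type} [DecidableEq V] (s : Bool → V → V) (o d : V) : ℕ → V × (V → Bool)
  | 0 => (o, fun _ => false)
  | k + 1 =>
      if (runState s o d k).1 = d then runState s o d k
      else trainStep s (runState s o d k)

/-- The partial run profile after `k` steps of the run of the train from `o` to `d`:
for each edge `(v, s b v)` (encoded by the pair `v`, `b`) the number of times the train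
has traversed it during the first `k` steps. -/
def runProfile {V : Type} [DecidableEq V] (s : Bool → V → V) (o d : V) : ℕ → V → Bool → ℕ
  | 0 => fun _ _ => 0
  | k + 1 =>
      if (runState s o d k).1 = d then runProfile s o d k
      else fun v b =>
        runProfile s o d k v b +
          if v = (runState s o d k).1 ∧ b = (runState s o d k).2 (runState s o d k).1
          then 1 else 0

/-- `f : V → Bool → ℕ` (where `f v b` is the value on the edge `(v, s b v)`) is a
switching flow from `o` to `v`: Kirchhoff's law and the parity condition hold. -/
def IsSwitchingFlow {V : Type} [Fintype V] [DecidableEq V] (s : Bool → V → V)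
    (o v : V) (f : V → Bool → ℕ) : Prop :=
  (∀ u : V,
      ((∑ w : V, ∑ b : Bool, if s b w = u then (f w b : ℤ) else 0)
          - ((f u false : ℤ) + (f u true : ℤ)))
        = (if u = v then 1 else 0) - (if u = o then 1 else 0)) ∧
  (∀ u : V, f u true ≤ f u false ∧ f u false ≤ f u true + 1)

/-- The edge `(v, s b v)` belongs to the graph of last-used edges `G*_f`. -/
def LastUsed {V : Type} (f : V → Bool → ℕ) (v : V) (b : Bool) : Prop :=
  (b = false ∧ f v false ≠ f v true) ∨ (b = true ∧ f v false = f v true ∧ 0 < f v true)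

/-- Adjacency of the graph of last-used edges `G*_f`. -/
def GstarAdj {V : Type} (s : Bool → V → V) (f : V → Bool → ℕ) (u w : V) : Prop :=
  ∃ b : Bool, LastUsed f u b ∧ s b u = w

/-- `c` is a directed cycle of the binary relation `adj`: a nonempty list of pairwise
distinct vertices with `adj` holding along the list cyclically. -/
def IsCycle {V : Type} (adj : V → V → Prop) (c : List V) : Prop :=
  c ≠ [] ∧ c.Nodup ∧
    ∀ i : Fin c.length, adj (c.get i) (c.get ⟨(i.1 + 1) % c.length, Nat.mod_lt _ i.pos⟩)

section Cycles

variable {V : Type} {adj : V → V → Prop}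

theorem IsCycle.exists_adj {c : List V} (hc : IsCycle adj c) {a : V} (ha : a ∈ c) :
    ∃ b ∈ c, adj a b := by
  obtain ⟨i, rfl⟩ := List.mem_iff_get.1 ha
  exact ⟨_, List.get_mem _ _, hc.2.2 i⟩

/-- A set closed under successors which meets a cycle contains that cycle. -/
theorem IsCycle.mem_of_closed {c : List V} (hc : IsCycle adj c) {S : Set V}
    (hS : ∀ a ∈ S, ∀ b, adj a b → b ∈ S) {x y : V} (hx : x ∈ c) (hxS : x ∈ S) (hy : y ∈ c) :
    y ∈ S := by
  obtain ⟨i, rfl⟩ := List.mem_iff_get.1 hx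
  obtain ⟨j, rfl⟩ := List.mem_iff_get.1 hy
  have key : ∀ m : ℕ, c.get ⟨(i.1 + m) % c.length, Nat.mod_lt _ i.pos⟩ ∈ S := by
    intro m
    induction m with
    | zero => simpa [Nat.mod_eq_of_lt i.2] using hxS
    | succ m ih =>
      have h := hS _ ih _ (hc.2.2 _)
      simpa [Nat.add_assoc] using h
  have h := key (j.1 + c.length - i.1)
  have e : i.1 + (j.1 + c.length - i.1) = j.1 + c.length := by omega
  simpa [e, Nat.mod_eq_of_lt j.2] using h

theorem isCycle_of_isChain {a : V} {l : List V} (hl : (a :: l).IsChain adj)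
    (hnd : (a :: l).Nodup) (hlast : adj ((a :: l).getLast (List.cons_ne_nil a l)) a) :
    IsCycle adj (a :: l) := by
  refine ⟨List.cons_ne_nil a l, hnd, fun i => ?_⟩
  by_cases hi : i.1 + 1 < (a :: l).length
  · have h := List.isChain_iff_getElem.1 hl i.1 hi
    have e : (i.1 + 1) % (l.length + 1) = i.1 + 1 := Nat.mod_eq_of_lt hi
    simpa [e] using h
  · have e : i.1 + 1 = (a :: l).length := by omega
    have e' : i.1 = (a :: l).length - 1 := by omega
    rw [List.getLast_eq_getElem] at hlast
    simpa [e, e'] using hlast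

/-- If a rank increases along all edges not starting at `u`, and all such edges lead to
vertices with a successor, then every vertex with a successor is joined to `u` by a path
along which the rank increases. -/
theorem exists_isChain_getLast_eq {u : V} {τ : V → ℕ} {N : ℕ} (hN : ∀ a, τ a ≤ N)
    (hτ : ∀ a b, a ≠ u → adj a b → (∃ c, adj b c) ∧ τ a < τ b) (a : V) (ha : ∃ b, adj a b) :
    ∃ l : List V, (a :: l).IsChain (fun x y => adj x y ∧ τ x < τ y) ∧
      (a :: l).getLast (List.cons_ne_nil a l) = u := by
  induction hn : N - τ a using Nat.strong_induction_on generalizing a with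
  | _ n ih =>
    by_cases hau : a = u
    · exact ⟨[], by simp, by simpa using hau⟩
    · obtain ⟨b, hb⟩ := ha
      obtain ⟨hbc, hlt⟩ := hτ a b hau hb
      have := hN b
      obtain ⟨l, hl, hlast⟩ := ih (N - τ b) (by omega) b hbc rfl
      exact ⟨b :: l, List.IsChain.cons_cons ⟨hb, hlt⟩ hl, by simpa using hlast⟩

/-- Under the same rank condition, every cycle passes through `u`. -/
theorem IsCycle.mem_of_rank {u : V} {τ : V → ℕ}
    (hτ : ∀ a b, a ≠ u → adj a b → τ a < τ b) {c : List V} (hc : IsCycle adj c) : u ∈ c := by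
  classical
  by_contra hu
  obtain ⟨x, hx, hmax⟩ := c.toFinset.exists_max_image τ
    (by simpa [List.toFinset_nonempty_iff] using hc.1)
  rw [List.mem_toFinset] at hx
  obtain ⟨y, hy, hxy⟩ := hc.exists_adj hx
  have h1 := hτ x y (fun e => hu (e ▸ hx)) hxy
  have h2 := hmax y (List.mem_toFinset.2 hy)
  omega

theorem pred_or_exists_unique_cycle [DecidableEq V] {u v : V} {τ : V → ℕ} {N : ℕ}
    (hN : ∀ a, τ a ≤ N) (hfun : ∀ a b c, adj a b → adj a c → b = c) (huv : adj u v)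
    (hτ : ∀ a b, a ≠ u → adj a b → (∃ c, adj b c) ∧ τ a < τ b) :
    (adj u v ∧ ∀ w, adj w v → w = u) ∨
    ∃ c : List V, IsCycle adj c ∧
      (∀ c' : List V, IsCycle adj c' → c'.toFinset = c.toFinset) ∧ v ∈ c ∧ u ∈ c ∧ adj u v := by
  by_cases hv : ∃ b, adj v b
  · right
    obtain ⟨l, hl, hlast⟩ := exists_isChain_getLast_eq hN hτ v hv
    have hnd : (v :: l).Nodup := by
      have h1 : (v :: l).IsChain (fun x y => τ x < τ y) := hl.imp fun _ _ h => h.2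
      have : IsTrans V (fun x y => τ x < τ y) := ⟨fun _ _ _ => lt_trans⟩
      exact h1.pairwise.imp fun h e => by simp [e] at h
    have hc : IsCycle adj (v :: l) :=
      isCycle_of_isChain (hl.imp fun _ _ h => h.1) hnd (by rw [hlast]; exact huv)
    have closed : ∀ c : List V, IsCycle adj c →
        ∀ a ∈ {x | x ∈ c}, ∀ b, adj a b → b ∈ {x | x ∈ c} := by
      intro c hc a ha b hab
      obtain ⟨b', hb', hab'⟩ := hc.exists_adj ha
      exact hfun a b b' hab hab' ▸ hb'
    have hu : ∀ c : List V, IsCycle adj c → u ∈ c := fun c hc =>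
      hc.mem_of_rank fun a b hau hab => (hτ a b hau hab).2
    refine ⟨v :: l, hc, fun c' hc' => ?_, by simp, hu _ hc, huv⟩
    ext x
    rw [List.mem_toFinset, List.mem_toFinset]
    exact ⟨hc'.mem_of_closed (closed _ hc) (hu _ hc') (hu _ hc),
      hc.mem_of_closed (closed _ hc') (hu _ hc) (hu _ hc')⟩
  · left
    refine ⟨huv, fun w hw => ?_⟩
    by_contra hwu
    exact hv (hτ w v hwu hw).1

end Cycles

section Run

theorem GstarAdj.unique {V : Type} {s : Bool → V → V} {f : V → Bool → ℕ} {a b c : V}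
    (hb : GstarAdj s f a b) (hc : GstarAdj s f a c) : b = c := by
  obtain ⟨x, hx, rfl⟩ := hb
  obtain ⟨y, hy, rfl⟩ := hc
  have : x = y := by
    unfold LastUsed at hx hy
    grind
  rw [this]

variable {V : Type} [DecidableEq V] (s : Bool → V → V) (o d : V)

/-- The switch at a vertex records the parity of the number of departures from it. -/
theorem runProfile_false_eq (k : ℕ) (v : V) :
    runProfile s o d k v false =
      runProfile s o d k v true + if (runState s o d k).2 v then 1 else 0 := by
  induction k with
  | zero => simp [runProfile, runState]
  | succ k ih =>
    by_cases hd : (runState s o d k).1 = d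
    · simpa [runProfile, runState, hd] using ih
    · by_cases hv : v = (runState s o d k).1
      · subst hv
        cases hb : (runState s o d k).2 (runState s o d k).1 <;>
          simp_all [runProfile, runState, trainStep]
      · simpa [runProfile, runState, trainStep, hd, hv] using ih

variable {s o d} {k : ℕ}

theorem gstarAdj_runProfile_succ_of_ne (h : (runState s o d k).1 ≠ d) {a b : V}
    (ha : a ≠ (runState s o d k).1) :
    GstarAdj s (runProfile s o d (k + 1)) a b ↔ GstarAdj s (runProfile s o d k) a b := by
  simp [GstarAdj, LastUsed, runProfile, h, ha]

theorem gstarAdj_runProfile_succ_self (h : (runState s o d k).1 ≠ d) :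
    GstarAdj s (runProfile s o d (k + 1)) (runState s o d k).1 (runState s o d (k + 1)).1 := by
  refine ⟨(runState s o d k).2 (runState s o d k).1, ?_, by simp [runState, h, trainStep]⟩
  have := runProfile_false_eq s o d k (runState s o d k).1
  cases hb : (runState s o d k).2 (runState s o d k).1 <;>
    simp_all [LastUsed, runProfile]

/-- If a rank bounded by `k` increases along all last-used edges not entering the current
vertex, then moving that vertex to the top rank gives such a rank after the next step. -/
theorem rank_update_step (h : (runState s o d k).1 ≠ d) {τ : V → ℕ} (hk : ∀ a, τ a ≤ k)
    (hτ : ∀ a b, GstarAdj s (runProfile s o d k) a b → b = (runState s o d k).1 ∨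
      ((∃ c, GstarAdj s (runProfile s o d k) b c) ∧ τ a < τ b)) :
    ∃ τ' : V → ℕ, (∀ a, τ' a ≤ k + 1) ∧
      ∀ a b, a ≠ (runState s o d k).1 → GstarAdj s (runProfile s o d (k + 1)) a b →
        (∃ c, GstarAdj s (runProfile s o d (k + 1)) b c) ∧ τ' a < τ' b := by
  refine ⟨Function.update τ (runState s o d k).1 (k + 1), fun a => ?_, fun a b ha hab => ?_⟩
  · have := hk a
    rw [Function.update_apply]
    split_ifs <;> omega
  · rw [Function.update_of_ne ha]
    by_cases hb : b = (runState s o d k).1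
    · subst hb
      rw [Function.update_self]
      exact ⟨⟨_, gstarAdj_runProfile_succ_self h⟩, Nat.lt_succ_of_le (hk a)⟩
    · rw [Function.update_of_ne hb]
      simpa only [gstarAdj_runProfile_succ_of_ne h hb] using
        (hτ a b ((gstarAdj_runProfile_succ_of_ne h ha).1 hab)).resolve_left hb

theorem exists_rank (s : Bool → V → V) (o d : V) (k : ℕ) :
    ∃ τ : V → ℕ, (∀ a, τ a ≤ k) ∧
      ∀ a b, GstarAdj s (runProfile s o d k) a b → b = (runState s o d k).1 ∨
        ((∃ c, GstarAdj s (runProfile s o d k) b c) ∧ τ a < τ b) := by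
  induction k with
  | zero => exact ⟨fun _ => 0, by simp, by simp [GstarAdj, LastUsed, runProfile]⟩
  | succ k ih =>
    obtain ⟨τ, hk, hτ⟩ := ih
    by_cases hd : (runState s o d k).1 = d
    · have h1 : runProfile s o d (k + 1) = runProfile s o d k := by simp [runProfile, hd]
      have h2 : runState s o d (k + 1) = runState s o d k := by simp [runState, hd]
      rw [h1, h2]
      exact ⟨τ, fun a => (hk a).trans k.le_succ, hτ⟩
    · obtain ⟨τ', hk', hτ'⟩ := rank_update_step hd hk hτ
      refine ⟨τ', hk', fun a b hab => ?_⟩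
      by_cases ha : a = (runState s o d k).1
      · subst ha
        exact Or.inl (hab.unique (gstarAdj_runProfile_succ_self hd))
      · exact Or.inr (hτ' a b ha hab)

end Run

/-- Let `r` be the partial run profile after `R = k + 1 ≥ 1` steps of
the run of the train from `o` to `d` (the train actually makes its `R`-th step, i.e.
it has not reached `d` within the first `k` steps), and let `u = (runState s o d k).1`
be the train's position after `R - 1` steps. Then either (i) the end-vertex `v_r` has
exactly one in-neighbor in `G*_r`, and this in-neighbor is `u`, or (ii) `G*_r` contains
exactly one directed cycle, this cycle contains `v_r`, and `u` is the predecessor of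
`v_r` on this cycle. -/
theorem predecessor_of_end_vertex_in_last_used_graph
    {V : Type} [Fintype V] [DecidableEq V] (s : Bool → V → V) (o d : V)
    (hd0 : s false d = d) (hd1 : s true d = d)
    (k : ℕ) (h : (runState s o d k).1 ≠ d) :
    (GstarAdj s (runProfile s o d (k + 1)) (runState s o d k).1 (runState s o d (k + 1)).1 ∧
      ∀ w : V, GstarAdj s (runProfile s o d (k + 1)) w (runState s o d (k + 1)).1 →
        w = (runState s o d k).1) ∨
    (∃ c : List V, IsCycle (GstarAdj s (runProfile s o d (k + 1))) c ∧
      (∀ c' : List V, IsCycle (GstarAdj s (runProfile s o d (k + 1))) c' →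
        c'.toFinset = c.toFinset) ∧
      (runState s o d (k + 1)).1 ∈ c ∧ (runState s o d k).1 ∈ c ∧
      GstarAdj s (runProfile s o d (k + 1)) (runState s o d k).1 (runState s o d (k + 1)).1) := by
  obtain ⟨τ, hk, hτ⟩ := exists_rank s o d k
  obtain ⟨τ', hk', hτ'⟩ := rank_update_step h hk hτ
  exact pred_or_exists_unique_cycle hk' (fun _ _ _ => GstarAdj.unique)
    (gstarAdj_runProfile_succ_self h) hτ'
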